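/- (Linear-term bound in the weighted bootstrap norm, L^∞/Besov version.) There is a constant C (depending only on the Littlewood–Paley bump φ) such that for all Schwartz functions u₀, u₁ on ℝ³, Σ_{N∈2^ℤ} sup_{t ∈ [0,∞)} (⟨tN⟩/N) ‖ P_N( cos(t|∇|) u₀ + (sin(t|∇|)/|∇|) u₁ ) ‖_{L^∞(ℝ³)} ≤ C [ ‖u₀‖_{Ḃ²_{1,1}} + ‖u₁‖_{Ḃ¹_{1,1}} ]. -/

import Mathlib

open MeasureTheory SchwartzMap Metric Set
open scoped ENNReal NNReal FourierTransform RealInnerProductSpace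

noncomputable section

abbrev E3 := EuclideanSpace ℝ (Fin 3)

/-- Fourier multiplier with symbol `m`. -/
def fmul3 (m : E3 → ℂ) (f : E3 → ℂ) : E3 → ℂ :=
  𝓕⁻ (fun ξ => m ξ * 𝓕 f ξ)

/-- The fractional derivative `|∇|^s`. -/
def absGrad3 (s : ℝ) (f : E3 → ℂ) : E3 → ℂ :=
  fmul3 (fun ξ => (((2 * Real.pi * ‖ξ‖) ^ s : ℝ) : ℂ)) f

/-- The half-wave propagator `e^{σ i t |∇|}`. -/
def halfWave3 (σ t : ℝ) (f : E3 → ℂ) : E3 → ℂ :=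
  fmul3 (fun ξ => Complex.exp (Complex.I * (σ * (2 * Real.pi * t * ‖ξ‖)))) f

/-- The propagator `cos(t|∇|)`. -/
def cosProp3 (t : ℝ) (f : E3 → ℂ) : E3 → ℂ :=
  fmul3 (fun ξ => ((Real.cos (2 * Real.pi * t * ‖ξ‖) : ℝ) : ℂ)) f

/-- The propagator `sin(t|∇|)/|∇|`. -/
def sinProp3 (t : ℝ) (g : E3 → ℂ) : E3 → ℂ :=
  fmul3 (fun ξ => ((Real.sin (2 * Real.pi * t * ‖ξ‖) / (2 * Real.pi * ‖ξ‖) : ℝ) : ℂ)) g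

/-- A Littlewood–Paley bump function. -/
structure IsLPBump3 (φ : E3 → ℝ) : Prop where
  smooth : ContDiff ℝ (⊤ : ℕ∞) φ
  mem_Icc : ∀ ξ, φ ξ ∈ Icc (0:ℝ) 1
  eq_one : ∀ ξ : E3, ‖ξ‖ ≤ 1 → φ ξ = 1
  eq_zero : ∀ ξ : E3, 2 ≤ ‖ξ‖ → φ ξ = 0

/-- The Littlewood–Paley projection `P_N`. -/
def LP3 (φ : E3 → ℝ) (N : ℝ) (f : E3 → ℂ) : E3 → ℂ :=
  fmul3 (fun ξ => ((φ (N⁻¹ • ξ) - φ ((2 / N) • ξ) : ℝ) : ℂ)) f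

/-- The homogeneous Besov norm `Ḃ^s_{p,1}`. -/
def besov3 (φ : E3 → ℝ) (s : ℝ) (p : ℝ≥0∞) (f : E3 → ℂ) : ℝ≥0∞ :=
  ∑' n : ℤ, ENNReal.ofReal (((2:ℝ) ^ n) ^ s) * eLpNorm (LP3 φ ((2:ℝ) ^ n) f) p volume

/-- The mixed spacetime norm `L_t^p L_x^q (J × ℝ³)`. -/
def mixedNorm3 (p q : ℝ≥0∞) (J : Set ℝ) (F : ℝ → E3 → ℂ) : ℝ≥0∞ :=
  if p = ∞ then essSup (fun t => eLpNorm (F t) q volume) (volume.restrict J)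
  else (∫⁻ t in J, (eLpNorm (F t) q volume) ^ p.toReal) ^ (1 / p.toReal)

/-- Time derivative `∂ₜ u`. -/
def dt (u : ℝ → E3 → ℝ) (t : ℝ) (x : E3) : ℝ := deriv (fun s => u s x) t

/-- Second time derivative `∂ₜ² u`. -/
def dtt (u : ℝ → E3 → ℝ) (t : ℝ) (x : E3) : ℝ := deriv (fun s => dt u s x) t

/-- The spatial Laplacian: sum of second partial derivatives. -/
def lap3 (f : E3 → ℝ) (x : E3) : ℝ :=
  ∑ i : Fin 3,
    fderiv ℝ (fun y => fderiv ℝ f y (EuclideanSpace.single i (1:ℝ))) x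
      (EuclideanSpace.single i (1:ℝ))

/-- A Schwartz solution of the energy-critical NLW `∂ₜ²u - Δu + ε u⁵ = 0` on `ℝ × ℝ³`:
a jointly smooth function, all of whose time derivatives are Schwartz in space at each time,
solving the equation pointwise. -/
structure IsNLWSolution (ε : ℝ) (u : ℝ → E3 → ℝ) : Prop where
  smooth : ContDiff ℝ (⊤ : ℕ∞) (fun p : ℝ × E3 => u p.1 p.2)
  schwartz : ∀ (k : ℕ) (t : ℝ), ∃ g : 𝓢(E3, ℝ), ∀ x,
    iteratedDeriv k (fun s => u s x) t = g x
  eqn : ∀ t x, dtt u t x - lap3 (u t) x + ε * (u t x) ^ 5 = 0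

/-- `‖∇f‖_{L²}`. -/
def gradL2 (f : E3 → ℝ) : ℝ≥0∞ := eLpNorm (fun x => ‖fderiv ℝ f x‖) 2 volume

/-- `‖(f,g)‖_{Ḣ¹ × L²} = ‖∇f‖_{L²} + ‖g‖_{L²}`. -/
def H1L2 (f g : E3 → ℝ) : ℝ≥0∞ := gradL2 f + eLpNorm g 2 volume

/-- The ground state `W(x) = (1 + |x|²/3)^{-1/2}`. -/
def Wfn : E3 → ℝ := fun x => (1 + ‖x‖ ^ 2 / 3) ^ (-(1/2) : ℝ)

/-- The (focusing-sign) energy `E(f,g) = ∫ ½|∇f|² + ½g² - ⅙f⁶`. -/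
def energyKM (f g : E3 → ℝ) : ℝ :=
  ∫ x, ((1/2) * ‖fderiv ℝ f x‖ ^ 2 + (1/2) * g x ^ 2 - (1/6) * f x ^ 6)

/-- The Kenig–Merle condition: `E(u₀,u₁) < E(W,0)` and `‖∇u₀‖₂ < ‖∇W‖₂`. -/
def KenigMerle (f g : E3 → ℝ) : Prop :=
  energyKM f g < energyKM Wfn (fun _ => 0) ∧ gradL2 f < gradL2 Wfn

/-- Coercion of a real-valued function to a complex-valued one. -/
def rc (f : E3 → ℝ) : E3 → ℂ := fun x => (f x : ℂ)

/-- The surface measure of the unit sphere of `E3`. -/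
abbrev sphereMeasure3 : Measure (sphere (0 : E3) 1) := (volume : Measure E3).toSphere

theorem integral_ball_polar_E3 {f : E3 → ℂ} (hf : Continuous f) {R : ℝ} (hR : 0 ≤ R) :
    ∫ x in ball (0 : E3) R, f x =
      ∫ r in (0 : ℝ)..R, (r ^ 2 : ℝ) • ∫ ω : sphere (0 : E3) 1, f (r • ω.1) ∂sphereMeasure3 := by
  set g : E3 → ℂ := (ball (0 : E3) R).indicator f with hg
  have hgi : Integrable g := by
    rw [hg, integrable_indicator_iff measurableSet_ball]
    exact (hf.continuousOn.integrableOn_compact (isCompact_closedBall 0 R)).mono_set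
      ball_subset_closedBall
  have hmp := (volume : Measure E3).measurePreserving_homeomorphUnitSphereProd
  have hemb := (homeomorphUnitSphereProd E3).measurableEmbedding
  let G : sphere (0 : E3) 1 × Ioi (0 : ℝ) → ℂ := fun p => g (p.2.1 • p.1.1)
  have hcomp : ∀ x : ({0}ᶜ : Set E3), G (homeomorphUnitSphereProd E3 x) = g x.1 := by
    intro x
    have hx : x.1 ≠ 0 := x.2
    simp [G, smul_smul, hx]
  have hGi : Integrable G (sphereMeasure3.prod (Measure.volumeIoiPow (Module.finrank ℝ E3 - 1))) := by
    rw [← hmp.integrable_comp_emb hemb]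
    have : G ∘ (homeomorphUnitSphereProd E3) = fun x : ({0}ᶜ : Set E3) => g x.1 := funext hcomp
    rw [this]
    exact (integrableOn_iff_comap_subtypeVal (measurableSet_singleton _).compl).1 hgi.integrableOn
  have hfin : Module.finrank ℝ E3 - 1 = 2 := by simp
  calc ∫ x in ball (0 : E3) R, f x = ∫ x, g x := (integral_indicator measurableSet_ball).symm
    _ = ∫ x : ({0}ᶜ : Set E3), g x.1 ∂(Measure.comap Subtype.val volume) := by
      rw [integral_subtype_comap (measurableSet_singleton _).compl, restrict_compl_singleton]
    _ = ∫ p, G p ∂(sphereMeasure3.prod (Measure.volumeIoiPow (Module.finrank ℝ E3 - 1))) := by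
      rw [← hmp.integral_comp hemb]
      simp only [hcomp]
    _ = ∫ r : Ioi (0 : ℝ), ∫ ω : sphere (0 : E3) 1, g (r.1 • ω.1) ∂sphereMeasure3
          ∂(Measure.volumeIoiPow (Module.finrank ℝ E3 - 1)) := integral_prod_symm G hGi
    _ = ∫ r in Ioi (0 : ℝ), (r ^ 2 : ℝ) • ∫ ω : sphere (0 : E3) 1, g (r • ω.1) ∂sphereMeasure3 := by
      rw [hfin]
      simp only [Measure.volumeIoiPow, ENNReal.ofReal]
      rw [integral_withDensity_eq_integral_smul (by fun_prop),
        integral_subtype_comap measurableSet_Ioi fun r : ℝ ↦ Real.toNNReal (r ^ 2) •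
          ∫ ω : sphere (0 : E3) 1, g (r • ω.1) ∂sphereMeasure3]
      refine setIntegral_congr_fun measurableSet_Ioi fun r hr => ?_
      simp only [NNReal.smul_def, Real.coe_toNNReal _ (sq_nonneg r)]
    _ = ∫ r in Ioi (0 : ℝ), (Iio R).indicator (fun r : ℝ => (r ^ 2 : ℝ) •
          ∫ ω : sphere (0 : E3) 1, f (r • ω.1) ∂sphereMeasure3) r := by
      refine setIntegral_congr_fun measurableSet_Ioi fun r hr => ?_
      have hr : 0 < r := hr
      have hn : ∀ ω : sphere (0 : E3) 1, ‖r • ω.1‖ = r := fun ω => by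
        simp [norm_smul, abs_of_pos hr]
      by_cases h : r < R
      · simp [hg, indicator, h, hn]
      · simp [hg, indicator, h, hn]
    _ = _ := by
      rw [setIntegral_indicator measurableSet_Iio, Ioi_inter_Iio,
        intervalIntegral.integral_of_le hR, integral_Ioc_eq_integral_Ioo]

theorem lintegral_polar_E3 {f : E3 → ℝ≥0∞} (hf : Measurable f) :
    ∫⁻ x, f x = ∫⁻ ω : sphere (0 : E3) 1, (∫⁻ r in Ioi (0 : ℝ),
      ENNReal.ofReal (r ^ 2) * f (r • ω.1)) ∂sphereMeasure3 := by
  have hmp := (volume : Measure E3).measurePreserving_homeomorphUnitSphereProd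
  have hemb := (homeomorphUnitSphereProd E3).measurableEmbedding
  let G : sphere (0 : E3) 1 × Ioi (0 : ℝ) → ℝ≥0∞ := fun p => f (p.2.1 • p.1.1)
  have hGm : Measurable G := hf.comp (by fun_prop)
  have hcomp : ∀ x : ({0}ᶜ : Set E3), G (homeomorphUnitSphereProd E3 x) = f x.1 := by
    intro x
    have hx : x.1 ≠ 0 := x.2
    simp [G, smul_smul, hx]
  have hfin : Module.finrank ℝ E3 - 1 = 2 := by simp
  calc
    ∫⁻ x, f x = ∫⁻ x : ({0}ᶜ : Set E3), f x.1 ∂(Measure.comap Subtype.val volume) := by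
      rw [lintegral_subtype_comap (measurableSet_singleton _).compl, restrict_compl_singleton]
    _ = ∫⁻ p, G p ∂(sphereMeasure3.prod (Measure.volumeIoiPow (Module.finrank ℝ E3 - 1))) := by
      rw [← hmp.lintegral_comp_emb hemb]
      simp only [hcomp]
    _ = ∫⁻ ω : sphere (0 : E3) 1, (∫⁻ r : Ioi (0 : ℝ), f (r.1 • ω.1)
          ∂(Measure.volumeIoiPow (Module.finrank ℝ E3 - 1))) ∂sphereMeasure3 :=
      lintegral_prod G hGm.aemeasurable
    _ = _ := by
      rw [hfin]
      refine lintegral_congr fun ω => ?_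
      have hm : Measurable fun r : Ioi (0 : ℝ) => f (r.1 • ω.1) := hf.comp (by fun_prop)
      rw [Measure.volumeIoiPow, lintegral_withDensity_eq_lintegral_mul _ (by fun_prop) hm,
        ← lintegral_subtype_comap measurableSet_Ioi fun r : ℝ ↦
          ENNReal.ofReal (r ^ 2) * f (r • ω.1)]
      rfl

theorem exists_orthonormalBasis_smul_eq (a : E3) :
    ∃ b : OrthonormalBasis (Fin 3) ℝ E3, ‖a‖ • b 0 = a := by
  by_cases ha : a = 0
  · exact ⟨EuclideanSpace.basisFun (Fin 3) ℝ, by simp [ha]⟩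
  have hn : ‖a‖ ≠ 0 := by simpa using ha
  have hv : Orthonormal ℝ (({0} : Set (Fin 3)).domRestrict fun _ => ‖a‖⁻¹ • a) := by
    constructor
    · intro i
      simp [domRestrict, norm_smul, hn]
    · rintro ⟨i, hi⟩ ⟨j, hj⟩ hij
      exact absurd (Subtype.ext (hi.trans hj.symm)) hij
  obtain ⟨b, hb⟩ := hv.exists_orthonormalBasis_extension_of_card_eq (by simp)
  refine ⟨b, ?_⟩
  rw [hb 0 rfl, smul_smul, mul_inv_cancel₀ hn, one_smul]

theorem volume_sq_add_sq_lt (c : ℝ) :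
    (volume : Measure (Fin 2 → ℝ)).real {y | y 0 ^ 2 + y 1 ^ 2 < c} = Real.pi * max c 0 := by
  have h1 := (EuclideanSpace.volume_preserving_symm_measurableEquiv_toLp (Fin 2)).measure_preimage_emb
    (MeasurableEquiv.measurableEmbedding _) {y : Fin 2 → ℝ | y 0 ^ 2 + y 1 ^ 2 < c}
  have h2 : (MeasurableEquiv.toLp 2 (Fin 2 → ℝ)).symm ⁻¹' {y : Fin 2 → ℝ | y 0 ^ 2 + y 1 ^ 2 < c} =
      ball (0 : EuclideanSpace ℝ (Fin 2)) (Real.sqrt c) := by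
    ext y
    simp only [mem_preimage, mem_ofPred_eq, mem_ball_zero_iff, EuclideanSpace.norm_eq,
      Fin.sum_univ_two, Real.norm_eq_abs, sq_abs]
    rw [Real.sqrt_lt_sqrt_iff (by positivity)]
    rfl
  rw [measureReal_def, ← h1, h2, EuclideanSpace.volume_ball_fin_two, ENNReal.toReal_mul,
    ENNReal.toReal_pow, ENNReal.toReal_ofReal (Real.sqrt_nonneg _),
    ENNReal.toReal_ofReal Real.pi_pos.le, mul_comm]
  rcases le_total c 0 with h | h
  · simp [Real.sqrt_eq_zero_of_nonpos h, h]
  · rw [Real.sq_sqrt h, max_eq_left h]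

theorem integral_ball_slice (F : ℝ → ℂ) (hF : Continuous F) (a : E3) {R : ℝ} (hR : 0 ≤ R) :
    ∫ x in ball (0 : E3) R, F (inner ℝ a x) =
      ∫ u in (-R)..R, (Real.pi * (R ^ 2 - u ^ 2) : ℝ) • F (‖a‖ * u) := by
  obtain ⟨b, hb⟩ := exists_orthonormalBasis_smul_eq a
  let S : Set (Fin 3 → ℝ) := {y | y 0 ^ 2 + y 1 ^ 2 + y 2 ^ 2 < R ^ 2}
  let T : Set (ℝ × (Fin 2 → ℝ)) := {p | p.1 ^ 2 + p.2 0 ^ 2 + p.2 1 ^ 2 < R ^ 2}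
  have hT : MeasurableSet T := measurableSet_lt (by fun_prop) (by fun_prop)
  let H : ℝ × (Fin 2 → ℝ) → ℂ := T.indicator fun p => F (‖a‖ * p.1)
  have e1 := b.measurePreserving_repr
  have e2 := EuclideanSpace.volume_preserving_symm_measurableEquiv_toLp (Fin 3)
  have e3 := volume_preserving_piFinSuccAbove (fun _ : Fin 3 => ℝ) 0
  have h1 : ∫ x in ball (0 : E3) R, F (inner ℝ a x) = ∫ y in ball (0 : E3) R, F (‖a‖ * y 0) := by
    rw [← e1.setIntegral_preimage_emb b.repr.toHomeomorph.measurableEmbedding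
      (fun y : E3 => F (‖a‖ * y 0)) (ball 0 R)]
    have : b.repr ⁻¹' ball (0 : E3) R = ball 0 R := by
      ext x
      simp
    rw [this]
    refine setIntegral_congr_fun measurableSet_ball fun x _ => ?_
    beta_reduce
    rw [b.repr_apply_apply, ← real_inner_smul_left, hb]
  have h2 : ∫ y in ball (0 : E3) R, F (‖a‖ * y 0) = ∫ y in S, F (‖a‖ * y 0) := by
    rw [← e2.setIntegral_preimage_emb (MeasurableEquiv.measurableEmbedding _)]
    have : (MeasurableEquiv.toLp 2 (Fin 3 → ℝ)).symm ⁻¹' S = ball (0 : E3) R := by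
      ext y
      rw [mem_ball_zero_iff, ← sq_lt_sq₀ (norm_nonneg _) hR, EuclideanSpace.real_norm_sq_eq,
        Fin.sum_univ_three]
      rfl
    rw [this]
    rfl
  have h3 : ∫ y in S, F (‖a‖ * y 0) = ∫ p in T, F (‖a‖ * p.1) := by
    rw [← e3.setIntegral_preimage_emb (MeasurableEquiv.measurableEmbedding _)]
    rfl
  have hHi : Integrable H := by
    rw [integrable_indicator_iff hT]
    have hsub : T ⊆ Icc ((-R : ℝ), fun _ => -R) (R, fun _ => R) := by
      rintro ⟨u, y⟩ h
      have h : u ^ 2 + y 0 ^ 2 + y 1 ^ 2 < R ^ 2 := h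
      have h0 := abs_le_of_sq_le_sq' (a := u) (b := R) (by nlinarith [sq_nonneg (y 0), sq_nonneg (y 1)]) hR
      have h1 := abs_le_of_sq_le_sq' (a := y 0) (b := R) (by nlinarith [sq_nonneg u, sq_nonneg (y 1)]) hR
      have h2 := abs_le_of_sq_le_sq' (a := y 1) (b := R) (by nlinarith [sq_nonneg (y 0), sq_nonneg u]) hR
      refine ⟨⟨h0.1, fun i => ?_⟩, ⟨h0.2, fun i => ?_⟩⟩ <;> fin_cases i <;> simp_all
    exact ((hF.comp (by fun_prop : Continuous fun p : ℝ × (Fin 2 → ℝ) =>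
      ‖a‖ * p.1)).continuousOn.integrableOn_compact isCompact_Icc).mono_set hsub
  rw [h1, h2, h3, ← integral_indicator hT, Measure.volume_eq_prod, integral_prod _ hHi]
  have h4 : ∀ u : ℝ, ∫ y : Fin 2 → ℝ, H (u, y) = (Real.pi * max (R ^ 2 - u ^ 2) 0) • F (‖a‖ * u) := by
    intro u
    have : (fun y : Fin 2 → ℝ => H (u, y)) =
        {y : Fin 2 → ℝ | y 0 ^ 2 + y 1 ^ 2 < R ^ 2 - u ^ 2}.indicator fun _ => F (‖a‖ * u) := by
      ext y
      simp only [H, T, indicator, mem_ofPred_eq]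
      refine if_congr ?_ rfl rfl
      constructor <;> intro h <;> linarith
    rw [this, integral_indicator_const _ (measurableSet_lt (by fun_prop) (by fun_prop)),
      volume_sq_add_sq_lt]
  rw [integral_congr_ae (.of_forall h4)]
  rw [intervalIntegral.integral_of_le (by linarith), ← integral_indicator measurableSet_Ioc]
  refine integral_congr_ae (.of_forall fun u => ?_)
  by_cases hu : u ∈ Ioc (-R) R
  · have : 0 ≤ R ^ 2 - u ^ 2 := by nlinarith [hu.1, hu.2]
    simp only [indicator_of_mem hu, max_eq_left this]
  · have : R ^ 2 - u ^ 2 ≤ 0 := by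
      by_contra! h
      have := abs_lt_of_sq_lt_sq' (by linarith : u ^ 2 < R ^ 2) hR
      exact hu ⟨this.1, this.2.le⟩
    simp [indicator_of_notMem hu, max_eq_right this]

theorem integral_parabola_mul_exp {k : ℝ} (hk : k ≠ 0) (R : ℝ) :
    ∫ u in (-R)..R, (Real.pi * (R ^ 2 - u ^ 2) : ℝ) • Complex.exp (((k * u : ℝ) : ℂ) * Complex.I) =
      Real.pi * (2 * R * Complex.exp (((k * R : ℝ) : ℂ) * Complex.I) / (k * Complex.I) ^ 2
        - 2 * Complex.exp (((k * R : ℝ) : ℂ) * Complex.I) / (k * Complex.I) ^ 3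
        + 2 * R * Complex.exp (((k * (-R) : ℝ) : ℂ) * Complex.I) / (k * Complex.I) ^ 2
        + 2 * Complex.exp (((k * (-R) : ℝ) : ℂ) * Complex.I) / (k * Complex.I) ^ 3) := by
  have hk' : (k : ℂ) ≠ 0 := by exact_mod_cast hk
  have hkI : (k * Complex.I : ℂ) ≠ 0 := mul_ne_zero hk' Complex.I_ne_zero
  let F : ℝ → ℂ := fun u => Real.pi * ((R ^ 2 - u ^ 2 : ℂ) / (k * Complex.I)
    + 2 * u / (k * Complex.I) ^ 2 - 2 / (k * Complex.I) ^ 3) *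
      Complex.exp (((k * u : ℝ) : ℂ) * Complex.I)
  have hF : ∀ u : ℝ, HasDerivAt F
      ((Real.pi * (R ^ 2 - u ^ 2) : ℝ) • Complex.exp (((k * u : ℝ) : ℂ) * Complex.I)) u := by
    intro u
    have h1 : HasDerivAt (fun u : ℝ => (u : ℂ)) 1 u := Complex.ofRealCLM.hasDerivAt
    have h2 : HasDerivAt (fun u : ℝ => Complex.exp (((k * u : ℝ) : ℂ) * Complex.I))
        (Complex.exp (((k * u : ℝ) : ℂ) * Complex.I) * (k * Complex.I)) u := by
      have := ((h1.const_mul (k : ℂ)).mul_const Complex.I).cexp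
      simpa using this
    have h3 := ((((((h1.pow 2).const_sub ((R : ℂ) ^ 2)).div_const (k * Complex.I)).add
      ((h1.const_mul 2).div_const ((k * Complex.I) ^ 2))).sub_const
        (2 / (k * Complex.I) ^ 3)).const_mul (Real.pi : ℂ)).mul h2
    refine h3.congr_deriv ?_
    simp only [Complex.real_smul]
    push_cast
    simp only [Pi.add_apply, Pi.pow_apply]
    field_simp
    ring
  rw [intervalIntegral.integral_eq_sub_of_hasDerivAt (fun u _ => hF u)
    (by apply Continuous.intervalIntegrable; fun_prop)]
  simp only [F]
  push_cast
  field_simp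
  ring

theorem continuous_integral_sphere {F : Type*} [NormedAddCommGroup F] [NormedSpace ℝ F]
    {X : Type*} [TopologicalSpace X] [FirstCountableTopology X]
    [LocallyCompactSpace X] (f : X → E3 → F) (hf : Continuous (Function.uncurry f)) :
    Continuous fun r => ∫ ω : sphere (0 : E3) 1, f r ω.1 ∂sphereMeasure3 := by
  have := continuous_parametric_integral_of_continuous (μ := sphereMeasure3)
    (f := fun (r : X) (ω : sphere (0 : E3) 1) => f r ω.1)
    (hf.comp (by fun_prop : Continuous fun p : X × sphere (0 : E3) 1 => (p.1, p.2.1)))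
    (isCompact_univ (X := sphere (0 : E3) 1))
  simpa using this

/-- The Fourier transform of the surface measure of the unit sphere. -/
theorem integral_sphere_exp {a : E3} (ha : a ≠ 0) {r : ℝ} (hr : 0 < r) :
    r * ∫ ω : sphere (0 : E3) 1,
      Complex.exp (((inner ℝ a (r • ω.1) : ℝ) : ℂ) * Complex.I) ∂sphereMeasure3 =
      ((4 * Real.pi * (Real.sin (r * ‖a‖) / ‖a‖) : ℝ) : ℂ) := by
  set H : ℝ → ℂ := fun r => ∫ ω : sphere (0 : E3) 1,
      Complex.exp (((inner ℝ a (r • ω.1) : ℝ) : ℂ) * Complex.I) ∂sphereMeasure3 with hH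
  have hHc : Continuous H := continuous_integral_sphere
    (fun (r : ℝ) (x : E3) => Complex.exp (((inner ℝ a (r • x) : ℝ) : ℂ) * Complex.I))
    (by unfold Function.uncurry; fun_prop)
  have hk : ‖a‖ ≠ 0 := by simpa using ha
  set k := ‖a‖ with hkdef
  have hk' : (k : ℂ) ≠ 0 := by exact_mod_cast hk
  let J : ℝ → ℂ := fun R =>
      Real.pi * (2 * R * Complex.exp (((k * R : ℝ) : ℂ) * Complex.I) / (k * Complex.I) ^ 2
        - 2 * Complex.exp (((k * R : ℝ) : ℂ) * Complex.I) / (k * Complex.I) ^ 3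
        + 2 * R * Complex.exp (((k * (-R) : ℝ) : ℂ) * Complex.I) / (k * Complex.I) ^ 2
        + 2 * Complex.exp (((k * (-R) : ℝ) : ℂ) * Complex.I) / (k * Complex.I) ^ 3)
  have hJ : ∀ R : ℝ, 0 ≤ R → ∫ s in (0 : ℝ)..R, (s ^ 2 : ℝ) • H s = J R := by
    intro R hR
    rw [← integral_ball_polar_E3
      (f := fun x => Complex.exp (((inner ℝ a x : ℝ) : ℂ) * Complex.I)) (by fun_prop) hR,
      integral_ball_slice (fun u => Complex.exp ((u : ℂ) * Complex.I)) (by fun_prop) a hR,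
      integral_parabola_mul_exp hk]
  have hd1 : HasDerivAt (fun R => ∫ s in (0 : ℝ)..R, (s ^ 2 : ℝ) • H s) ((r ^ 2 : ℝ) • H r) r := by
    have hc : Continuous fun s : ℝ => (s ^ 2 : ℝ) • H s := by fun_prop
    exact intervalIntegral.integral_hasDerivAt_right (hc.intervalIntegrable _ _)
      (hc.stronglyMeasurableAtFilter _ _) hc.continuousAt
  have hd2 : HasDerivAt J ((r ^ 2 : ℝ) • H r) r := by
    refine hd1.congr_of_eventuallyEq ?_
    filter_upwards [lt_mem_nhds hr] with R hR using (hJ R hR.le).symm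
  have hd3 : HasDerivAt J (Real.pi * (2 * r * Complex.exp (((k * r : ℝ) : ℂ) * Complex.I) /
      (k * Complex.I) - 2 * r * Complex.exp (((k * (-r) : ℝ) : ℂ) * Complex.I) /
      (k * Complex.I))) r := by
    have h1 : HasDerivAt (fun u : ℝ => (u : ℂ)) 1 r := Complex.ofRealCLM.hasDerivAt
    have h2 : HasDerivAt (fun u : ℝ => Complex.exp (((k * u : ℝ) : ℂ) * Complex.I))
        (Complex.exp (((k * r : ℝ) : ℂ) * Complex.I) * (k * Complex.I)) r := by
      have := ((h1.const_mul (k : ℂ)).mul_const Complex.I).cexp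
      simpa using this
    have h3 : HasDerivAt (fun u : ℝ => Complex.exp (((k * (-u) : ℝ) : ℂ) * Complex.I))
        (Complex.exp (((k * (-r) : ℝ) : ℂ) * Complex.I) * (-(k * Complex.I))) r := by
      have := ((h1.neg.const_mul (k : ℂ)).mul_const Complex.I).cexp
      simpa using this
    have h4 := ((((((h1.const_mul 2).mul h2).div_const ((k * Complex.I) ^ 2)).sub
      ((h2.const_mul 2).div_const ((k * Complex.I) ^ 3))).add
      ((((h1.const_mul 2).mul h3).div_const ((k * Complex.I) ^ 2)))).add
      ((h3.const_mul 2).div_const ((k * Complex.I) ^ 3))).const_mul (Real.pi : ℂ)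
    refine h4.congr_deriv ?_
    field_simp
    ring
  have heq := hd2.unique hd3
  have hr' : (r : ℂ) ≠ 0 := by exact_mod_cast hr.ne'
  have hsin : (((Real.sin (r * k)) : ℝ) : ℂ) = (Complex.exp (((k * (-r) : ℝ) : ℂ) * Complex.I) -
      Complex.exp (((k * r : ℝ) : ℂ) * Complex.I)) * Complex.I / 2 := by
    rw [Complex.ofReal_sin, Complex.sin]
    push_cast
    ring_nf
  push_cast at hsin ⊢
  rw [hsin]
  rw [Complex.real_smul] at heq
  push_cast at heq
  apply mul_left_cancel₀ hr'
  rw [← mul_assoc, ← sq, heq]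
  field_simp
  linear_combination 4 * (Complex.exp (r * k * Complex.I) - Complex.exp (-(r * k * Complex.I))) *
    Complex.I_sq

theorem enorm_le_lintegral_ray {F : Type*} [NormedAddCommGroup F] [NormedSpace ℝ F]
    [CompleteSpace F] (h : 𝓢(E3, F)) (x : E3) {ω : E3} (hω : ‖ω‖ = 1) (τ : ℝ) :
    ‖h (x + τ • ω)‖ₑ ≤ ∫⁻ r in Ioi τ, ‖fderiv ℝ h (x + r • ω)‖ₑ := by
  have hd : ∀ r : ℝ, HasDerivAt (fun r : ℝ => h (x + r • ω)) (fderiv ℝ h (x + r • ω) ω) r := by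
    intro r
    have h1 : HasDerivAt (fun r : ℝ => x + r • ω) ω r := by
      simpa using ((hasDerivAt_id r).smul_const ω).const_add x
    exact (h.differentiable _).hasFDerivAt.comp_hasDerivAt r h1
  have hfc : Continuous (fderiv ℝ h) := (h.smooth 1).continuous_fderiv (by simp)
  have hc : Continuous fun r : ℝ => fderiv ℝ h (x + r • ω) ω :=
    (hfc.comp (by fun_prop)).clm_apply continuous_const
  have hle : ∫⁻ r in Ioi τ, ‖fderiv ℝ h (x + r • ω) ω‖ₑ ≤
      ∫⁻ r in Ioi τ, ‖fderiv ℝ h (x + r • ω)‖ₑ := by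
    refine lintegral_mono fun r => ?_
    have := (fderiv ℝ h (x + r • ω)).le_opENorm ω
    rwa [← ofReal_norm ω, hω, ENNReal.ofReal_one, mul_one] at this
  refine le_trans ?_ hle
  by_cases hfin : ∫⁻ r in Ioi τ, ‖fderiv ℝ h (x + r • ω) ω‖ₑ = ∞
  · simp [hfin]
  have hint : IntegrableOn (fun r : ℝ => fderiv ℝ h (x + r • ω) ω) (Ioi τ) :=
    ⟨hc.aestronglyMeasurable, lt_top_iff_ne_top.2 hfin⟩
  have hlim : Filter.Tendsto (fun r : ℝ => h (x + r • ω)) Filter.atTop (nhds 0) := by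
    have hray : Filter.Tendsto (fun r : ℝ => x + r • ω) Filter.atTop (Filter.cocompact E3) := by
      rw [← cobounded_eq_cocompact, ← tendsto_norm_atTop_iff_cobounded]
      refine Filter.tendsto_atTop_mono (f := fun r : ℝ => r - ‖x‖) (fun r => ?_)
        (Filter.tendsto_atTop_add_const_right _ _ Filter.tendsto_id)
      have h1 : ‖r • ω‖ ≤ ‖x + r • ω‖ + ‖x‖ := by
        simpa using norm_sub_le (x + r • ω) x
      rw [norm_smul, hω, mul_one, Real.norm_eq_abs] at h1
      linarith [le_abs_self r]
    exact (SchwartzMap.tendsto_cocompact h).comp hray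
  have := integral_Ioi_of_hasDerivAt_of_tendsto (hd τ).continuousAt.continuousWithinAt
    (fun r _ => hd r) hint hlim
  rw [zero_sub] at this
  rw [← enorm_neg, ← this]
  exact enorm_integral_le_lintegral_enorm _

theorem lintegral_sphere_le {F : Type*} [NormedAddCommGroup F] [NormedSpace ℝ F]
    [CompleteSpace F] (h : 𝓢(E3, F)) (x : E3) {τ : ℝ} (hτ : 0 < τ) :
    ∫⁻ ω : sphere (0 : E3) 1, ‖h (x + τ • ω.1)‖ₑ ∂sphereMeasure3 ≤
      ENNReal.ofReal ((τ ^ 2)⁻¹) * ∫⁻ y, ‖fderiv ℝ h y‖ₑ := by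
  have hfc : Continuous (fderiv ℝ h) := (h.smooth 1).continuous_fderiv (by simp)
  rw [← lintegral_add_left_eq_self _ x, lintegral_polar_E3 (by fun_prop),
    ← lintegral_const_mul' _ _ ENNReal.ofReal_ne_top]
  refine lintegral_mono fun ω => ?_
  refine (enorm_le_lintegral_ray h x (by simp) τ).trans ?_
  rw [← lintegral_const_mul' _ _ ENNReal.ofReal_ne_top]
  refine le_trans ?_ (lintegral_mono_set (Ioi_subset_Ioi hτ.le))
  refine setLIntegral_mono' measurableSet_Ioi fun r hr => ?_
  have hr : τ < r := hr
  rw [← mul_assoc, ← ENNReal.ofReal_mul (by positivity)]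
  refine le_mul_of_one_le_left zero_le ?_
  rw [ENNReal.one_le_ofReal, inv_mul_eq_div, one_le_div (by positivity)]
  gcongr

theorem integrable_sphere_translate {F : Type*} [NormedAddCommGroup F] [NormedSpace ℝ F]
    {g : E3 → F} (hc : Continuous g) (hg : Integrable g) (t : ℝ) :
    Integrable (fun p : E3 × sphere (0 : E3) 1 => g (p.1 + t • p.2.1))
      (volume.prod sphereMeasure3) := by
  rw [integrable_prod_iff' (by
    exact (hc.comp (by fun_prop : Continuous fun p : E3 × sphere (0 : E3) 1 =>
      p.1 + t • p.2.1)).aestronglyMeasurable)]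
  refine ⟨.of_forall fun ω => hg.comp_add_right (t • ω.1), ?_⟩
  have : ∀ ω : sphere (0 : E3) 1, ∫ x, ‖g (x + t • ω.1)‖ = ∫ x, ‖g x‖ := fun ω =>
    integral_add_right_eq_self (fun x => ‖g x‖) (t • ω.1)
  simp only [this]
  exact integrable_const _

theorem abs_sin_div_le (t : ℝ) {n : ℝ} (hn : 0 ≤ n) :
    |Real.sin (2 * Real.pi * t * n) / (2 * Real.pi * n)| ≤ |t| := by
  rcases hn.eq_or_lt with rfl | hn
  · simp
  have hp : 0 < 2 * Real.pi * n := by positivity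
  rw [abs_div, abs_of_pos hp, div_le_iff₀ hp]
  refine Real.abs_sin_le_abs.trans (le_of_eq ?_)
  rw [show 2 * Real.pi * t * n = t * (2 * Real.pi * n) by ring, abs_mul, abs_of_pos hp]

theorem mul_integral_sphere_exp_two_pi {ξ : E3} (hξ : ξ ≠ 0) {t : ℝ} (ht : 0 ≤ t) :
    t * ∫ ω : sphere (0 : E3) 1,
      Complex.exp (((2 * Real.pi * inner ℝ ξ (t • ω.1) : ℝ) : ℂ) * Complex.I) ∂sphereMeasure3 =
      4 * Real.pi * ((Real.sin (2 * Real.pi * t * ‖ξ‖) / (2 * Real.pi * ‖ξ‖) : ℝ) : ℂ) := by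
  rcases ht.eq_or_lt with rfl | ht
  · simp
  have h := integral_sphere_exp (a := (2 * Real.pi) • ξ)
    (smul_ne_zero (by positivity) hξ) ht
  simp only [real_inner_smul_left, norm_smul, Real.norm_eq_abs,
    abs_of_pos (by positivity : 0 < 2 * Real.pi)] at h
  rw [h]
  push_cast
  ring_nf

/-- Kirchhoff's formula for the propagator `sin(t|∇|)/|∇|`. -/
theorem fourierInv_sin_mul_eq (ψ : 𝓢(E3, ℂ)) {t : ℝ} (ht : 0 ≤ t) (x : E3) :
    𝓕⁻ (fun ξ : E3 => ((Real.sin (2 * Real.pi * t * ‖ξ‖) / (2 * Real.pi * ‖ξ‖) : ℝ) : ℂ) * ψ ξ) x =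
      t / (4 * Real.pi) * ∫ ω : sphere (0 : E3) 1, (𝓕⁻ ψ) (x + t • ω.1) ∂sphereMeasure3 := by
  have hg : ∀ y : E3, (𝓕⁻ ψ) y =
      ∫ ξ : E3, Complex.exp (((2 * Real.pi * inner ℝ ξ y : ℝ) : ℂ) * Complex.I) • ψ ξ := by
    intro y
    rw [SchwartzMap.fourierInv_coe, Real.fourierInv_eq']
  have hpi : (Real.pi : ℂ) ≠ 0 := by exact_mod_cast Real.pi_ne_zero
  simp only [hg]
  rw [integral_integral_swap]
  · rw [Real.fourierInv_eq', ← integral_const_mul]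
    refine integral_congr_ae ?_
    filter_upwards [compl_mem_ae_iff.2 (measure_singleton (0 : E3))] with ξ hξ
    have h := mul_integral_sphere_exp_two_pi hξ ht
    have : ∀ ω : sphere (0 : E3) 1,
        Complex.exp (((2 * Real.pi * inner ℝ ξ (x + t • ω.1) : ℝ) : ℂ) * Complex.I) • ψ ξ =
        (Complex.exp (((2 * Real.pi * inner ℝ ξ x : ℝ) : ℂ) * Complex.I) * ψ ξ) *
        Complex.exp (((2 * Real.pi * inner ℝ ξ (t • ω.1) : ℝ) : ℂ) * Complex.I) := by
      intro ω
      rw [inner_add_right, mul_add, Complex.ofReal_add, add_mul, Complex.exp_add, smul_eq_mul]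
      ring
    simp only [this]
    rw [integral_const_mul, smul_eq_mul]
    generalize (∫ ω : sphere (0 : E3) 1,
      Complex.exp (((2 * Real.pi * inner ℝ ξ (t • ω.1) : ℝ) : ℂ) * Complex.I) ∂sphereMeasure3) = A
      at h ⊢
    generalize ((Real.sin (2 * Real.pi * t * ‖ξ‖) / (2 * Real.pi * ‖ξ‖) : ℝ) : ℂ) = B at h ⊢
    rw [show B = t * A / (4 * Real.pi) by rw [h]; field_simp]
    field_simp
  · refine Integrable.mono (ψ.integrable.comp_snd sphereMeasure3) ?_ ?_
    · refine Continuous.aestronglyMeasurable ?_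
      unfold Function.uncurry
      fun_prop
    · refine .of_forall fun p => ?_
      simp [Function.uncurry, Complex.norm_exp]

theorem hasDerivAt_integral_sphere (g : 𝓢(E3, ℂ)) (x : E3) (t : ℝ) :
    HasDerivAt (fun t : ℝ => ∫ ω : sphere (0 : E3) 1, g (x + t • ω.1) ∂sphereMeasure3)
      (∫ ω : sphere (0 : E3) 1, fderiv ℝ g (x + t • ω.1) ω.1 ∂sphereMeasure3) t := by
  have hfc : Continuous (fderiv ℝ g) := (g.smooth 1).continuous_fderiv (by simp)
  obtain ⟨C, hC⟩ : ∃ C : ℝ, ∀ y, ‖fderiv ℝ g y‖ ≤ C := by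
    obtain ⟨C, hC⟩ := (SchwartzMap.fderivCLM ℝ E3 ℂ g).decay 0 0
    exact ⟨C, fun y => by simpa using hC.2 y⟩
  refine (hasDerivAt_integral_of_dominated_loc_of_deriv_le (𝕜 := ℝ) (μ := sphereMeasure3) (x₀ := t)
    (F := fun (t : ℝ) (ω : sphere (0 : E3) 1) => g (x + t • ω.1))
    (F' := fun (t : ℝ) (ω : sphere (0 : E3) 1) => fderiv ℝ g (x + t • ω.1) ω.1)
    (bound := fun _ => C) Filter.univ_mem ?_ ?_ ?_ ?_ (integrable_const _) ?_).2
  · exact .of_forall fun s => (g.continuous.comp (by fun_prop)).aestronglyMeasurable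
  · have : Continuous fun ω : sphere (0 : E3) 1 => g (x + t • ω.1) :=
      g.continuous.comp (by fun_prop)
    exact this.integrable_of_hasCompactSupport (HasCompactSupport.of_compactSpace _)
  · exact ((hfc.comp (by fun_prop)).clm_apply (by fun_prop)).aestronglyMeasurable
  · refine .of_forall fun ω s _ => ?_
    refine ((fderiv ℝ g _).le_opNorm _).trans ?_
    simpa using hC _
  · refine .of_forall fun ω s _ => ?_
    have h1 : HasDerivAt (fun r : ℝ => x + r • ω.1) ω.1 s := by
      simpa using ((hasDerivAt_id s).smul_const ω.1).const_add x
    exact (g.differentiable _).hasFDerivAt.comp_hasDerivAt s h1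

theorem hasDerivAt_fourierInv_sin_mul (ψ : 𝓢(E3, ℂ)) (t : ℝ) (x : E3) :
    HasDerivAt (fun t : ℝ => 𝓕⁻ (fun ξ : E3 =>
      ((Real.sin (2 * Real.pi * t * ‖ξ‖) / (2 * Real.pi * ‖ξ‖) : ℝ) : ℂ) * ψ ξ) x)
      (𝓕⁻ (fun ξ : E3 => ((Real.cos (2 * Real.pi * t * ‖ξ‖) : ℝ) : ℂ) * ψ ξ) x) t := by
  simp only [Real.fourierInv_eq']
  have hm : ∀ s : ℝ, Measurable fun ξ : E3 =>
      Complex.exp (((2 * Real.pi * inner ℝ ξ x : ℝ) : ℂ) * Complex.I) •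
        (((Real.sin (2 * Real.pi * s * ‖ξ‖) / (2 * Real.pi * ‖ξ‖) : ℝ) : ℂ) * ψ ξ) := by
    intro s
    have := ψ.continuous.measurable
    fun_prop
  refine (hasDerivAt_integral_of_dominated_loc_of_deriv_le (𝕜 := ℝ) (μ := volume) (x₀ := t)
    (F' := fun (t : ℝ) (ξ : E3) => Complex.exp (((2 * Real.pi * inner ℝ ξ x : ℝ) : ℂ) * Complex.I) •
      (((Real.cos (2 * Real.pi * t * ‖ξ‖) : ℝ) : ℂ) * ψ ξ))
    (bound := fun ξ => ‖ψ ξ‖) Filter.univ_mem (.of_forall fun s => (hm s).aestronglyMeasurable)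
    ?_ ?_ ?_ ψ.integrable.norm ?_).2
  · refine Integrable.mono' (ψ.integrable.norm.const_mul |t|) (hm t).aestronglyMeasurable
      (.of_forall fun ξ => ?_)
    rw [norm_smul, Complex.norm_exp_ofReal_mul_I, one_mul, norm_mul, Complex.norm_real,
      Real.norm_eq_abs]
    refine mul_le_mul_of_nonneg_right ?_ (norm_nonneg _)
    exact abs_sin_div_le t (norm_nonneg ξ)
  · exact Continuous.aestronglyMeasurable (by fun_prop)
  · refine .of_forall fun ξ s _ => ?_
    rw [norm_smul, Complex.norm_exp_ofReal_mul_I, one_mul, norm_mul, Complex.norm_real]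
    exact mul_le_of_le_one_left (norm_nonneg _) (Real.abs_cos_le_one _)
  · filter_upwards [compl_mem_ae_iff.2 (measure_singleton (0 : E3))] with ξ hξ s _
    have hn : ‖ξ‖ ≠ 0 := by simpa using hξ
    have h1 : HasDerivAt (fun s : ℝ => Real.sin (2 * Real.pi * s * ‖ξ‖) / (2 * Real.pi * ‖ξ‖))
        (Real.cos (2 * Real.pi * s * ‖ξ‖)) s := by
      have := ((((hasDerivAt_id s).const_mul (2 * Real.pi)).mul_const ‖ξ‖).sin).div_const
        (2 * Real.pi * ‖ξ‖)
      refine this.congr_deriv ?_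
      simp only [id]
      field_simp
    exact (h1.ofReal_comp.mul_const (ψ ξ)).const_mul _

/-- Kirchhoff's formula for the propagator `cos(t|∇|)`. -/
theorem fourierInv_cos_mul_eq (ψ : 𝓢(E3, ℂ)) {t : ℝ} (ht : 0 ≤ t) (x : E3) :
    𝓕⁻ (fun ξ : E3 => ((Real.cos (2 * Real.pi * t * ‖ξ‖) : ℝ) : ℂ) * ψ ξ) x =
      1 / (4 * Real.pi) * (∫ ω : sphere (0 : E3) 1, (𝓕⁻ ψ) (x + t • ω.1) ∂sphereMeasure3 +
        t * ∫ ω : sphere (0 : E3) 1, fderiv ℝ (𝓕⁻ ψ : 𝓢(E3, ℂ)) (x + t • ω.1) ω.1 ∂sphereMeasure3) := by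
  have hpi : (Real.pi : ℂ) ≠ 0 := by exact_mod_cast Real.pi_ne_zero
  rcases ht.eq_or_lt with rfl | ht
  · have hσ : sphereMeasure3.real univ = 4 * Real.pi := by
      rw [Measure.toSphere_real_apply_univ, measureReal_def, EuclideanSpace.volume_ball_fin_three,
        ENNReal.toReal_mul, ENNReal.toReal_pow, ENNReal.toReal_ofReal zero_le_one,
        ENNReal.toReal_ofReal (by positivity)]
      simp
      ring
    simp [hσ, SchwartzMap.fourierInv_coe]
    field_simp
  · have h1 : HasDerivAt (fun t : ℝ => (t : ℂ) / (4 * Real.pi)) (1 / (4 * Real.pi)) t := by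
      have : HasDerivAt (fun u : ℝ => (u : ℂ)) 1 t := Complex.ofRealCLM.hasDerivAt
      exact this.div_const _
    have h2 := h1.mul (hasDerivAt_integral_sphere (𝓕⁻ ψ) x t)
    have h3 := (hasDerivAt_fourierInv_sin_mul ψ t x).congr_of_eventuallyEq
      (f₁ := fun t : ℝ => (t : ℂ) / (4 * Real.pi) *
        ∫ ω : sphere (0 : E3) 1, (𝓕⁻ ψ) (x + t • ω.1) ∂sphereMeasure3) (by
        filter_upwards [lt_mem_nhds ht] with s hs using (fourierInv_sin_mul_eq ψ hs.le x).symm)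
    rw [h3.unique h2]
    ring

theorem exists_norm_integral_sphere_le {F : Type*} [NormedAddCommGroup F] [NormedSpace ℝ F]
    [CompleteSpace F] (h : 𝓢(E3, F)) : ∃ A : ℝ, 0 ≤ A ∧ ∀ τ : ℝ, 0 < τ → ∀ x : E3,
      ∀ f : E3 → E3 → ℂ, (∀ y ω : E3, ‖ω‖ = 1 → ‖f y ω‖ ≤ ‖h y‖) →
      ‖∫ ω : sphere (0 : E3) 1, f (x + τ • ω.1) ω.1 ∂sphereMeasure3‖ ≤ A / τ ^ 2 := by
  refine ⟨∫ y, ‖fderiv ℝ h y‖, integral_nonneg fun _ => norm_nonneg _, fun τ hτ x f hf => ?_⟩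
  have hint : Integrable (fderiv ℝ h) := (SchwartzMap.fderivCLM ℝ E3 F h).integrable
  rw [← ENNReal.ofReal_le_ofReal_iff (by positivity), ofReal_norm]
  calc ‖∫ ω : sphere (0 : E3) 1, f (x + τ • ω.1) ω.1 ∂sphereMeasure3‖ₑ
      ≤ ∫⁻ ω : sphere (0 : E3) 1, ‖f (x + τ • ω.1) ω.1‖ₑ ∂sphereMeasure3 :=
        enorm_integral_le_lintegral_enorm _
    _ ≤ ∫⁻ ω : sphere (0 : E3) 1, ‖h (x + τ • ω.1)‖ₑ ∂sphereMeasure3 :=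
        lintegral_mono fun ω => enorm_le_iff_norm_le.2 (hf _ _ (by simp))
    _ ≤ ENNReal.ofReal ((τ ^ 2)⁻¹) * ∫⁻ y, ‖fderiv ℝ h y‖ₑ := lintegral_sphere_le h x hτ
    _ = _ := by
      rw [← ofReal_integral_norm_eq_lintegral_enorm hint, ← ENNReal.ofReal_mul (by positivity),
        inv_mul_eq_div]

theorem norm_fourierInv_mul_le (ψ : 𝓢(E3, ℂ)) {m : E3 → ℝ} {c : ℝ} (hm : ∀ ξ, |m ξ| ≤ c) (x : E3) :
    ‖𝓕⁻ (fun ξ : E3 => ((m ξ : ℝ) : ℂ) * ψ ξ) x‖ ≤ c * ∫ ξ, ‖ψ ξ‖ := by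
  rw [Real.fourierInv_eq', ← integral_const_mul]
  refine norm_integral_le_of_norm_le (ψ.integrable.norm.const_mul c) (.of_forall fun ξ => ?_)
  rw [norm_smul, Complex.norm_exp_ofReal_mul_I, one_mul, norm_mul, Complex.norm_real]
  exact mul_le_mul_of_nonneg_right (hm ξ) (norm_nonneg _)

theorem exists_norm_fourierInv_sin_mul_le (ψ : 𝓢(E3, ℂ)) :
    ∃ C : ℝ, 0 ≤ C ∧ ∀ τ : ℝ, 0 ≤ τ → ∀ x : E3, (1 + τ) * ‖𝓕⁻ (fun ξ : E3 =>
      ((Real.sin (2 * Real.pi * τ * ‖ξ‖) / (2 * Real.pi * ‖ξ‖) : ℝ) : ℂ) * ψ ξ) x‖ ≤ C := by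
  obtain ⟨A, hA, h⟩ := exists_norm_integral_sphere_le (𝓕⁻ ψ : 𝓢(E3, ℂ))
  have hI : 0 ≤ ∫ ξ, ‖ψ ξ‖ := integral_nonneg fun _ => norm_nonneg _
  refine ⟨2 * A + 2 * ∫ ξ, ‖ψ ξ‖, by positivity, fun τ hτ x => ?_⟩
  rcases le_total τ 1 with h1 | h1
  · have := norm_fourierInv_mul_le ψ (fun ξ => (abs_sin_div_le τ (norm_nonneg ξ)).trans
      ((abs_of_nonneg hτ).trans_le h1)) x
    nlinarith [norm_nonneg (𝓕⁻ (fun ξ : E3 =>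
      ((Real.sin (2 * Real.pi * τ * ‖ξ‖) / (2 * Real.pi * ‖ξ‖) : ℝ) : ℂ) * ψ ξ) x)]
  · have hτ' : 0 < τ := by linarith
    rw [fourierInv_sin_mul_eq ψ hτ, norm_mul]
    have h2 := h τ hτ' x (fun y _ => (𝓕⁻ ψ : 𝓢(E3, ℂ)) y) (fun _ _ _ => le_rfl)
    have h3 : ‖(τ / (4 * Real.pi) : ℂ)‖ ≤ τ := by
      have : (τ / (4 * Real.pi) : ℂ) = ((τ / (4 * Real.pi) : ℝ) : ℂ) := by push_cast; rfl
      rw [this, Complex.norm_real, Real.norm_eq_abs, abs_of_nonneg (by positivity)]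
      exact div_le_self hτ (by linarith [Real.pi_gt_three])
    calc _ ≤ (τ + τ) * (τ * (A / τ ^ 2)) := by gcongr
      _ = 2 * A := by field_simp; ring
      _ ≤ _ := by linarith

theorem exists_norm_fourierInv_cos_mul_le (ψ : 𝓢(E3, ℂ)) :
    ∃ C : ℝ, 0 ≤ C ∧ ∀ τ : ℝ, 0 ≤ τ → ∀ x : E3, (1 + τ) * ‖𝓕⁻ (fun ξ : E3 =>
      ((Real.cos (2 * Real.pi * τ * ‖ξ‖) : ℝ) : ℂ) * ψ ξ) x‖ ≤ C := by
  obtain ⟨A, hA, h⟩ := exists_norm_integral_sphere_le (𝓕⁻ ψ : 𝓢(E3, ℂ))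
  obtain ⟨B, hB, h'⟩ := exists_norm_integral_sphere_le
    (SchwartzMap.fderivCLM ℝ E3 ℂ (𝓕⁻ ψ : 𝓢(E3, ℂ)))
  have hI : 0 ≤ ∫ ξ, ‖ψ ξ‖ := integral_nonneg fun _ => norm_nonneg _
  refine ⟨2 * A + 2 * B + 2 * ∫ ξ, ‖ψ ξ‖, by positivity, fun τ hτ x => ?_⟩
  rcases le_total τ 1 with h1 | h1
  · have := norm_fourierInv_mul_le ψ (fun ξ => Real.abs_cos_le_one (2 * Real.pi * τ * ‖ξ‖)) x
    nlinarith [norm_nonneg (𝓕⁻ (fun ξ : E3 =>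
      ((Real.cos (2 * Real.pi * τ * ‖ξ‖) : ℝ) : ℂ) * ψ ξ) x)]
  · have hτ' : 0 < τ := by linarith
    rw [fourierInv_cos_mul_eq ψ hτ, norm_mul]
    have h2 := h τ hτ' x (fun y _ => (𝓕⁻ ψ : 𝓢(E3, ℂ)) y) (fun _ _ _ => le_rfl)
    have h4 := h' τ hτ' x (fun y ω => fderiv ℝ (𝓕⁻ ψ : 𝓢(E3, ℂ)) y ω) (fun y ω hω => by
      simpa [hω] using (fderiv ℝ (𝓕⁻ ψ : 𝓢(E3, ℂ)) y).le_opNorm ω)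
    have h3 : ‖(1 / (4 * Real.pi) : ℂ)‖ ≤ 1 := by
      have : (1 / (4 * Real.pi) : ℂ) = ((1 / (4 * Real.pi) : ℝ) : ℂ) := by push_cast; rfl
      rw [this, Complex.norm_real, Real.norm_eq_abs, abs_of_nonneg (by positivity)]
      exact div_le_self zero_le_one (by linarith [Real.pi_gt_three])
    have h5 : ‖(τ : ℂ)‖ = τ := by rw [Complex.norm_real, Real.norm_eq_abs, abs_of_nonneg hτ]
    calc _ ≤ (τ + τ) * (1 * (A / τ ^ 2 + τ * (B / τ ^ 2))) := by
          gcongr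
          refine (norm_add_le _ _).trans ?_
          rw [norm_mul, h5]
          gcongr
      _ = 2 * (A / τ) + 2 * B := by field_simp; ring
      _ ≤ 2 * A + 2 * B := by
          gcongr
          exact div_le_self hA h1
      _ ≤ _ := by linarith

theorem integrable_fourierInv_sin_mul (ψ : 𝓢(E3, ℂ)) {t : ℝ} (ht : 0 ≤ t) :
    Integrable (𝓕⁻ (fun ξ : E3 =>
      ((Real.sin (2 * Real.pi * t * ‖ξ‖) / (2 * Real.pi * ‖ξ‖) : ℝ) : ℂ) * ψ ξ)) := by
  rw [funext (fourierInv_sin_mul_eq ψ ht)]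
  exact (integrable_sphere_translate (𝓕⁻ ψ : 𝓢(E3, ℂ)).continuous
    (𝓕⁻ ψ : 𝓢(E3, ℂ)).integrable t).integral_prod_left.const_mul _

theorem integrable_fourierInv_cos_mul (ψ : 𝓢(E3, ℂ)) {t : ℝ} (ht : 0 ≤ t) :
    Integrable (𝓕⁻ (fun ξ : E3 => ((Real.cos (2 * Real.pi * t * ‖ξ‖) : ℝ) : ℂ) * ψ ξ)) := by
  rw [funext (fourierInv_cos_mul_eq ψ ht)]
  have hfc : Continuous (fderiv ℝ (𝓕⁻ ψ : 𝓢(E3, ℂ))) :=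
    ((𝓕⁻ ψ : 𝓢(E3, ℂ)).smooth 1).continuous_fderiv (by simp)
  have hfi : Integrable (fderiv ℝ (𝓕⁻ ψ : 𝓢(E3, ℂ))) :=
    (SchwartzMap.fderivCLM ℝ E3 ℂ (𝓕⁻ ψ : 𝓢(E3, ℂ))).integrable
  have h1 := (integrable_sphere_translate (𝓕⁻ ψ : 𝓢(E3, ℂ)).continuous
    (𝓕⁻ ψ : 𝓢(E3, ℂ)).integrable t).integral_prod_left
  have h2 : Integrable (fun p : E3 × sphere (0 : E3) 1 =>
      fderiv ℝ (𝓕⁻ ψ : 𝓢(E3, ℂ)) (p.1 + t • p.2.1) p.2.1) (volume.prod sphereMeasure3) := by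
    refine Integrable.mono (integrable_sphere_translate hfc hfi t) ?_ (.of_forall fun p => ?_)
    · exact ((hfc.comp (by fun_prop)).clm_apply (by fun_prop)).aestronglyMeasurable
    · simpa using (fderiv ℝ (𝓕⁻ ψ : 𝓢(E3, ℂ)) (p.1 + t • p.2.1)).le_opNorm p.2.1
  exact (h1.add (h2.integral_prod_left.const_mul _)).const_mul _

/-- The complexification of a real-valued Schwartz function. -/
def SchwartzMap.rc (u : 𝓢(E3, ℝ)) : 𝓢(E3, ℂ) where
  toFun := _root_.rc u
  smooth' := Complex.ofRealCLM.contDiff.comp (u.smooth ⊤)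
  decay' k n := by
    obtain ⟨C, hC⟩ := u.decay k n
    refine ⟨C, fun x => ?_⟩
    rw [show _root_.rc u = Complex.ofRealLI ∘ u from rfl,
      Complex.ofRealLI.norm_iteratedFDeriv_comp_left (u.smooth n).contDiffAt le_rfl]
    exact hC.2 x

/-- The symbol of the Littlewood–Paley projection `P_N`. -/
def lpSymbol (φ : E3 → ℝ) (N : ℝ) (ξ : E3) : ℂ :=
  ((φ (N⁻¹ • ξ) - φ ((2 / N) • ξ) : ℝ) : ℂ)

theorem lpSymbol_eq_lpSymbol_one (φ : E3 → ℝ) (N : ℝ) (ξ : E3) :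
    lpSymbol φ N ξ = lpSymbol φ 1 (N⁻¹ • ξ) := by
  simp [lpSymbol, smul_smul, div_eq_mul_inv]

theorem lpSymbol_zero (φ : E3 → ℝ) (N : ℝ) : lpSymbol φ N 0 = 0 := by
  simp [lpSymbol]

theorem IsLPBump3.exists_schwartz_lpSymbol {φ : E3 → ℝ} (hφ : IsLPBump3 φ) {N : ℝ} (hN : 0 < N) :
    ∃ ψ : 𝓢(E3, ℂ), ∀ ξ, ψ ξ = lpSymbol φ N ξ := by
  have h1 : ContDiff ℝ (⊤ : ℕ∞) (lpSymbol φ N) :=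
    Complex.ofRealCLM.contDiff.comp ((hφ.smooth.comp (contDiff_const_smul _)).sub
      (hφ.smooth.comp (contDiff_const_smul _)))
  have h2 : HasCompactSupport (lpSymbol φ N) := by
    refine HasCompactSupport.intro (isCompact_closedBall (0 : E3) (2 * N)) fun ξ hξ => ?_
    rw [mem_closedBall_zero_iff, not_le] at hξ
    have h : 2 ≤ N⁻¹ * ‖ξ‖ := by
      rw [inv_mul_eq_div, le_div_iff₀ hN]; exact hξ.le
    have e1 : φ (N⁻¹ • ξ) = 0 := hφ.eq_zero _ (by
      rw [norm_smul, Real.norm_eq_abs, abs_of_pos (by positivity)]; exact h)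
    have e2 : φ ((2 / N) • ξ) = 0 := hφ.eq_zero _ (by
      rw [norm_smul, Real.norm_eq_abs, abs_of_pos (by positivity), div_eq_mul_inv]; linarith)
    simp [lpSymbol, e1, e2]
  exact ⟨h2.toSchwartzMap h1, fun _ => rfl⟩

/-- The symbols of the three neighbouring projections sum to one on the support of `lpSymbol φ N`. -/
theorem IsLPBump3.lpSymbol_mul_eq {φ : E3 → ℝ} (hφ : IsLPBump3 φ) {N : ℝ} (hN : 0 < N) (ξ : E3) :
    lpSymbol φ N ξ * (lpSymbol φ (N / 2) ξ + lpSymbol φ N ξ + lpSymbol φ (2 * N) ξ) =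
      lpSymbol φ N ξ := by
  have hn (c : ℝ) (hc : 0 < c) : ‖c • ξ‖ = c * ‖ξ‖ := by
    rw [norm_smul, Real.norm_eq_abs, abs_of_pos hc]
  have e : lpSymbol φ (N / 2) ξ + lpSymbol φ N ξ + lpSymbol φ (2 * N) ξ =
      ((φ ((2 * N)⁻¹ • ξ) - φ ((4 / N) • ξ) : ℝ) : ℂ) := by
    have h1 : (N / 2)⁻¹ = 2 / N := by field_simp
    have h2 : 2 / (N / 2) = 4 / N := by field_simp; norm_num
    have h3 : 2 / (2 * N) = N⁻¹ := by field_simp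
    simp only [lpSymbol, h1, h2, h3]
    push_cast
    ring
  rw [e]
  rcases le_or_gt (2 * N) ‖ξ‖ with h | h
  · have e1 : φ (N⁻¹ • ξ) = 0 := hφ.eq_zero _ (by
      rw [hn _ (by positivity), inv_mul_eq_div, le_div_iff₀ hN]; exact h)
    have e2 : φ ((2 / N) • ξ) = 0 := hφ.eq_zero _ (by
      rw [hn _ (by positivity), div_mul_eq_mul_div, le_div_iff₀ hN]; linarith)
    simp [lpSymbol, e1, e2]
  rcases le_or_gt ‖ξ‖ (N / 2) with h' | h'
  · have e1 : φ (N⁻¹ • ξ) = 1 := hφ.eq_one _ (by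
      rw [hn _ (by positivity), inv_mul_eq_div, div_le_one₀ hN]; linarith)
    have e2 : φ ((2 / N) • ξ) = 1 := hφ.eq_one _ (by
      rw [hn _ (by positivity), div_mul_eq_mul_div, div_le_one₀ hN]; linarith)
    simp [lpSymbol, e1, e2]
  · have e1 : φ ((2 * N)⁻¹ • ξ) = 1 := hφ.eq_one _ (by
      rw [hn _ (by positivity), inv_mul_eq_div, div_le_one₀ (by positivity)]; exact h.le)
    have e2 : φ ((4 / N) • ξ) = 0 := hφ.eq_zero _ (by
      rw [hn _ (by positivity), div_mul_eq_mul_div, le_div_iff₀ hN]; linarith)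
    rw [e1, e2]
    simp

/-- Young's inequality `L¹ * L^∞ → L^∞` for Fourier multipliers. -/
theorem enorm_fmul3_le {m f : E3 → ℂ} (hm : Integrable m) (hf : Integrable f) {A : ℝ}
    (hA : ∀ y, ‖𝓕⁻ m y‖ ≤ A) (x : E3) :
    ‖fmul3 m f x‖ₑ ≤ ENNReal.ofReal A * eLpNorm f 1 volume := by
  have hm' : Integrable (fun ξ : E3 =>
      Complex.exp (((2 * Real.pi * inner ℝ ξ x : ℝ) : ℂ) * Complex.I) • m ξ) := by
    refine Integrable.mono hm ?_ (.of_forall fun ξ => ?_)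
    · exact (show Continuous fun ξ : E3 => Complex.exp (((2 * Real.pi * inner ℝ ξ x : ℝ) : ℂ) *
        Complex.I) by fun_prop).aestronglyMeasurable.smul hm.aestronglyMeasurable
    · rw [norm_smul, Complex.norm_exp_ofReal_mul_I, one_mul]
  have key : fmul3 m f x = ∫ y, f y • 𝓕⁻ m (x - y) := by
    have h := VectorFourier.integral_fourierIntegral_smul_eq_flip (L := innerₗ E3)
      Real.continuous_fourierChar continuous_inner hf hm'
    rw [flip_innerₗ] at h
    refine Eq.trans ?_ (h.trans ?_)
    · rw [fmul3, Real.fourierInv_eq']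
      refine integral_congr_ae (.of_forall fun ξ => ?_)
      change _ = 𝓕 f ξ • _
      simp only [smul_eq_mul]
      ring
    · refine integral_congr_ae (.of_forall fun y => ?_)
      change f y • 𝓕 (fun ξ : E3 =>
        Complex.exp (((2 * Real.pi * inner ℝ ξ x : ℝ) : ℂ) * Complex.I) • m ξ) y = _
      simp only
      rw [Real.fourier_eq', Real.fourierInv_eq']
      congr 1
      refine integral_congr_ae (.of_forall fun ξ => ?_)
      simp only
      rw [smul_smul, ← Complex.exp_add, inner_sub_right]
      congr 2
      push_cast
      ring
  rw [key]
  calc ‖∫ y, f y • 𝓕⁻ m (x - y)‖ₑ ≤ ∫⁻ y, ‖f y • 𝓕⁻ m (x - y)‖ₑ :=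
        enorm_integral_le_lintegral_enorm _
    _ ≤ ∫⁻ y, ENNReal.ofReal A * ‖f y‖ₑ := by
        refine lintegral_mono fun y => ?_
        rw [enorm_smul, mul_comm]
        gcongr
        rw [← ofReal_norm]
        exact ENNReal.ofReal_le_ofReal (hA _)
    _ = _ := by
        rw [lintegral_const_mul' _ _ ENNReal.ofReal_ne_top, eLpNorm_one_eq_lintegral_enorm]

theorem fourierInv_eq_of_comp_inv_smul {F G : E3 → ℂ} {N : ℝ} (hN : 0 < N)
    (hG : ∀ ξ, G ξ = F (N⁻¹ • ξ)) (x : E3) : 𝓕⁻ G x = N ^ 3 * 𝓕⁻ F (N • x) := by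
  rw [Real.fourierInv_eq', Real.fourierInv_eq']
  have h := Measure.integral_comp_inv_smul_of_nonneg (volume : Measure E3) (fun ξ : E3 =>
    Complex.exp (((2 * Real.pi * inner ℝ ξ (N • x) : ℝ) : ℂ) * Complex.I) • F ξ) hN.le
  rw [finrank_euclideanSpace_fin] at h
  rw [Complex.real_smul] at h
  push_cast at h ⊢
  rw [← h]
  refine integral_congr_ae (.of_forall fun ξ => ?_)
  simp only [real_inner_smul_left, real_inner_smul_right, hG]
  rw [mul_inv_cancel_left₀ hN.ne']

theorem IsLPBump3.exists_schwartz_LP3 {φ : E3 → ℝ} (hφ : IsLPBump3 φ) {N : ℝ} (hN : 0 < N)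
    (v : 𝓢(E3, ℂ)) : ∃ P : 𝓢(E3, ℂ), ⇑P = LP3 φ N v ∧
      ∀ ξ, (𝓕 P : 𝓢(E3, ℂ)) ξ = lpSymbol φ N ξ * (𝓕 v : 𝓢(E3, ℂ)) ξ := by
  obtain ⟨ψ, hψ⟩ := hφ.exists_schwartz_lpSymbol hN
  have hW : ∀ ξ, SchwartzMap.smulLeftCLM ℂ ψ (𝓕 v : 𝓢(E3, ℂ)) ξ =
      lpSymbol φ N ξ * (𝓕 v : 𝓢(E3, ℂ)) ξ := fun ξ => by
    rw [SchwartzMap.smulLeftCLM_apply_apply ψ.hasTemperateGrowth, hψ, smul_eq_mul]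
  refine ⟨𝓕⁻ (SchwartzMap.smulLeftCLM ℂ ψ (𝓕 v : 𝓢(E3, ℂ))), ?_, fun ξ => ?_⟩
  · rw [SchwartzMap.fourierInv_coe, funext hW]
    rfl
  · rw [FourierTransform.fourier_fourierInv_eq, hW]

theorem fourier_fmul3 {m : E3 → ℝ} {c : ℝ} (hm : Measurable m) (hc : ∀ ξ, |m ξ| ≤ c)
    (v : 𝓢(E3, ℂ)) (hi : Integrable (fmul3 (fun ξ => (m ξ : ℂ)) v)) {ξ : E3}
    (hξ : ContinuousAt m ξ) :
    𝓕 (fmul3 (fun ξ => (m ξ : ℂ)) v) ξ = m ξ * (𝓕 v : 𝓢(E3, ℂ)) ξ := by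
  have h1 : Integrable (fun ξ => (m ξ : ℂ) * (𝓕 v : 𝓢(E3, ℂ)) ξ) :=
    (𝓕 v : 𝓢(E3, ℂ)).integrable.bdd_mul (c := c)
      (Complex.measurable_ofReal.comp hm).aestronglyMeasurable
      (.of_forall fun ξ => by rw [Complex.norm_real]; exact hc ξ)
  refine h1.fourier_fourierInv_eq ?_
    ((Complex.continuous_ofReal.continuousAt.comp hξ).mul
      (𝓕 v : 𝓢(E3, ℂ)).continuous.continuousAt)
  have h2 := hi.comp_neg
  refine h2.congr (.of_forall fun y => ?_)
  change 𝓕⁻ (fun ξ => (m ξ : ℂ) * (𝓕 v : 𝓢(E3, ℂ)) ξ) (-y) = _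
  rw [Real.fourierInv_eq_fourier_neg, neg_neg]

/-- A multiplier bound localised to one frequency shell. -/
theorem IsLPBump3.enorm_fourierInv_lpSymbol_mul_le {φ : E3 → ℝ} (hφ : IsLPBump3 φ) {N : ℝ}
    (hN : 0 < N) {m : E3 → ℝ} {c : ℝ} (hm : Measurable m) (hc : ∀ ξ, |m ξ| ≤ c) {A : ℝ}
    (hA : ∀ y, ‖𝓕⁻ (fun ξ => (m ξ : ℂ) * lpSymbol φ N ξ) y‖ ≤ A) (v : 𝓢(E3, ℂ)) (x : E3) :
    ‖𝓕⁻ (fun ξ => lpSymbol φ N ξ * (m ξ * (𝓕 v : 𝓢(E3, ℂ)) ξ)) x‖ₑ ≤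
      ENNReal.ofReal A * (eLpNorm (LP3 φ (N / 2) v) 1 volume + eLpNorm (LP3 φ N v) 1 volume +
        eLpNorm (LP3 φ (2 * N) v) 1 volume) := by
  obtain ⟨ψ, hψ⟩ := hφ.exists_schwartz_lpSymbol hN
  obtain ⟨P, hP, hP'⟩ := hφ.exists_schwartz_LP3 (half_pos hN) v
  obtain ⟨Q, hQ, hQ'⟩ := hφ.exists_schwartz_LP3 hN v
  obtain ⟨R, hR, hR'⟩ := hφ.exists_schwartz_LP3 (mul_pos two_pos hN) v
  have hi : Integrable (fun ξ => (m ξ : ℂ) * lpSymbol φ N ξ) := by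
    rw [← funext hψ]
    exact ψ.integrable.bdd_mul (c := c)
      (Complex.measurable_ofReal.comp hm).aestronglyMeasurable
      (.of_forall fun ξ => by rw [Complex.norm_real]; exact hc ξ)
  have h := enorm_fmul3_le hi (P + Q + R).integrable hA x
  have e : (fun ξ => lpSymbol φ N ξ * (m ξ * (𝓕 v : 𝓢(E3, ℂ)) ξ)) =
      fun ξ => (m ξ : ℂ) * lpSymbol φ N ξ * 𝓕 (⇑(P + Q + R)) ξ := by
    funext ξ
    rw [← SchwartzMap.fourier_coe, FourierTransform.fourier_add, FourierTransform.fourier_add,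
      add_apply, add_apply, hP', hQ', hR']
    linear_combination (-(m ξ : ℂ) * (𝓕 v : 𝓢(E3, ℂ)) ξ) * hφ.lpSymbol_mul_eq hN ξ
  rw [e]
  refine h.trans ?_
  gcongr
  rw [← hP, ← hQ, ← hR]
  refine (eLpNorm_add_le (P + Q).continuous.aestronglyMeasurable
    R.continuous.aestronglyMeasurable le_rfl).trans ?_
  gcongr
  exact eLpNorm_add_le P.continuous.aestronglyMeasurable Q.continuous.aestronglyMeasurable le_rfl

/-- Dispersive estimate for the frequency-localised kernel of `cos(t|∇|)`. -/
theorem IsLPBump3.exists_norm_cos_kernel_le {φ : E3 → ℝ} (hφ : IsLPBump3 φ) :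
    ∃ C : ℝ, 0 ≤ C ∧ ∀ N t : ℝ, 0 < N → 0 ≤ t → ∀ y : E3, ‖𝓕⁻ (fun ξ : E3 =>
      ((Real.cos (2 * Real.pi * t * ‖ξ‖) : ℝ) : ℂ) * lpSymbol φ N ξ) y‖ ≤
        C * N ^ 3 / (1 + t * N) := by
  obtain ⟨ψ, hψ⟩ := hφ.exists_schwartz_lpSymbol one_pos
  obtain ⟨C, hC, h⟩ := exists_norm_fourierInv_cos_mul_le ψ
  refine ⟨C, hC, fun N t hN ht y => ?_⟩
  rw [fourierInv_eq_of_comp_inv_smul (F := fun η : E3 =>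
    ((Real.cos (2 * Real.pi * (t * N) * ‖η‖) : ℝ) : ℂ) * ψ η) hN fun ξ => by
      rw [hψ, ← lpSymbol_eq_lpSymbol_one, norm_smul, Real.norm_eq_abs, abs_of_pos (by positivity),
        show 2 * Real.pi * (t * N) * (N⁻¹ * ‖ξ‖) = 2 * Real.pi * t * ‖ξ‖ by field_simp], le_div_iff₀ (by positivity), norm_mul, norm_pow,
    Complex.norm_real, Real.norm_eq_abs, abs_of_pos hN]
  nlinarith [mul_le_mul_of_nonneg_left (h (t * N) (by positivity) (N • y)) (pow_pos hN 3).le]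

/-- Dispersive estimate for the frequency-localised kernel of `sin(t|∇|)/|∇|`. -/
theorem IsLPBump3.exists_norm_sin_kernel_le {φ : E3 → ℝ} (hφ : IsLPBump3 φ) :
    ∃ C : ℝ, 0 ≤ C ∧ ∀ N t : ℝ, 0 < N → 0 ≤ t → ∀ y : E3, ‖𝓕⁻ (fun ξ : E3 =>
      ((Real.sin (2 * Real.pi * t * ‖ξ‖) / (2 * Real.pi * ‖ξ‖) : ℝ) : ℂ) * lpSymbol φ N ξ) y‖ ≤
        C * N ^ 2 / (1 + t * N) := by
  obtain ⟨ψ, hψ⟩ := hφ.exists_schwartz_lpSymbol one_pos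
  obtain ⟨C, hC, h⟩ := exists_norm_fourierInv_sin_mul_le ψ
  refine ⟨C, hC, fun N t hN ht y => ?_⟩
  have e : ∀ ξ : E3, ((Real.sin (2 * Real.pi * t * ‖ξ‖) / (2 * Real.pi * ‖ξ‖) : ℝ) : ℂ) *
      lpSymbol φ N ξ = (fun η : E3 => (N : ℂ)⁻¹ *
        (((Real.sin (2 * Real.pi * (t * N) * ‖η‖) / (2 * Real.pi * ‖η‖) : ℝ) : ℂ) * ψ η))
        (N⁻¹ • ξ) := by
    intro ξ
    simp only
    rw [hψ, ← lpSymbol_eq_lpSymbol_one, norm_smul, Real.norm_eq_abs, abs_of_pos (by positivity),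
      show 2 * Real.pi * (t * N) * (N⁻¹ * ‖ξ‖) = 2 * Real.pi * t * ‖ξ‖ by field_simp, ← mul_assoc]
    congr 1
    push_cast
    have : (N : ℂ) ≠ 0 := by exact_mod_cast hN.ne'
    rw [← div_eq_inv_mul, div_div]
    congr 1
    field_simp
  have e2 : 𝓕⁻ (fun η : E3 => (N : ℂ)⁻¹ *
        (((Real.sin (2 * Real.pi * (t * N) * ‖η‖) / (2 * Real.pi * ‖η‖) : ℝ) : ℂ) * ψ η)) (N • y) =
      (N : ℂ)⁻¹ * 𝓕⁻ (fun η : E3 =>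
        ((Real.sin (2 * Real.pi * (t * N) * ‖η‖) / (2 * Real.pi * ‖η‖) : ℝ) : ℂ) * ψ η)
        (N • y) := by
    rw [Real.fourierInv_eq', Real.fourierInv_eq', ← integral_const_mul]
    refine integral_congr_ae (.of_forall fun ξ => ?_)
    simp only [smul_eq_mul]
    ring
  rw [fourierInv_eq_of_comp_inv_smul (F := fun η : E3 => (N : ℂ)⁻¹ *
        (((Real.sin (2 * Real.pi * (t * N) * ‖η‖) / (2 * Real.pi * ‖η‖) : ℝ) : ℂ) * ψ η)) hN e, e2, le_div_iff₀ (by positivity), norm_mul, norm_mul,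
    norm_inv, norm_pow, Complex.norm_real, Real.norm_eq_abs, abs_of_pos hN, ← mul_assoc,
    show N ^ 3 * N⁻¹ = N ^ 2 by field_simp]
  nlinarith [mul_le_mul_of_nonneg_left (h (t * N) (by positivity) (N • y)) (pow_pos hN 2).le]

theorem IsLPBump3.LP3_cosProp3_add_sinProp3 {φ : E3 → ℝ} (hφ : IsLPBump3 φ) {N t : ℝ} (hN : 0 < N)
    (ht : 0 ≤ t) (v w : 𝓢(E3, ℂ)) (x : E3) :
    LP3 φ N (fun x => cosProp3 t v x + sinProp3 t w x) x =
      𝓕⁻ (fun ξ : E3 => lpSymbol φ N ξ *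
        (((Real.cos (2 * Real.pi * t * ‖ξ‖) : ℝ) : ℂ) * (𝓕 v : 𝓢(E3, ℂ)) ξ)) x +
      𝓕⁻ (fun ξ : E3 => lpSymbol φ N ξ *
        (((Real.sin (2 * Real.pi * t * ‖ξ‖) / (2 * Real.pi * ‖ξ‖) : ℝ) : ℂ) *
          (𝓕 w : 𝓢(E3, ℂ)) ξ)) x := by
  obtain ⟨ψ, hψ⟩ := hφ.exists_schwartz_lpSymbol hN
  have hcm : Measurable fun ξ : E3 => Real.cos (2 * Real.pi * t * ‖ξ‖) := by fun_prop
  have hsm : Measurable fun ξ : E3 =>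
      Real.sin (2 * Real.pi * t * ‖ξ‖) / (2 * Real.pi * ‖ξ‖) := by fun_prop
  have hcb (ξ : E3) := Real.abs_cos_le_one (2 * Real.pi * t * ‖ξ‖)
  have hsb (ξ : E3) := abs_sin_div_le t (norm_nonneg ξ)
  have hci : Integrable (cosProp3 t v) := integrable_fourierInv_cos_mul (𝓕 v : 𝓢(E3, ℂ)) ht
  have hsi : Integrable (sinProp3 t w) := integrable_fourierInv_sin_mul (𝓕 w : 𝓢(E3, ℂ)) ht
  have hF (ξ : E3) (hξ : ξ ≠ 0) : 𝓕 (fun x => cosProp3 t v x + sinProp3 t w x) ξ =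
      ((Real.cos (2 * Real.pi * t * ‖ξ‖) : ℝ) : ℂ) * (𝓕 v : 𝓢(E3, ℂ)) ξ +
      ((Real.sin (2 * Real.pi * t * ‖ξ‖) / (2 * Real.pi * ‖ξ‖) : ℝ) : ℂ) *
        (𝓕 w : 𝓢(E3, ℂ)) ξ := by
    refine (congrFun (VectorFourier.fourierIntegral_add Real.continuous_fourierChar
      (L := innerₗ E3) continuous_inner hci hsi) ξ).trans ?_
    rw [← fourier_fmul3 hcm hcb v hci (by fun_prop), ← fourier_fmul3 hsm hsb w hsi ?_]
    · rfl
    · have : 2 * Real.pi * ‖ξ‖ ≠ 0 := by positivity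
      fun_prop (disch := assumption)
  have hint {m : E3 → ℝ} {c : ℝ} (hm : Measurable m) (hc : ∀ ξ, |m ξ| ≤ c) (u : 𝓢(E3, ℂ)) :
      Integrable fun ξ => lpSymbol φ N ξ * (m ξ * u ξ) := by
    obtain ⟨D, -, hD⟩ := ψ.decay 0 0
    rw [← funext hψ]
    refine (u.integrable.bdd_mul (c := c) (Complex.measurable_ofReal.comp hm).aestronglyMeasurable
      (.of_forall fun ξ => ?_)).bdd_mul (c := D) ψ.continuous.aestronglyMeasurable
      (.of_forall fun ξ => by simpa using hD ξ)
    rw [Function.comp_apply, Complex.norm_real]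
    exact hc ξ
  have hadd := congrFun (VectorFourier.fourierIntegral_add Real.continuous_fourierChar
    (L := -innerₗ E3) (μ := volume) (continuous_inner.neg) (hint hcm hcb (𝓕 v))
    (hint hsm hsb (𝓕 w))) x
  refine Eq.trans ?_ hadd
  refine congrArg (fun F : E3 → ℂ => 𝓕⁻ F x) (funext fun ξ => ?_)
  rw [Pi.add_apply, ← mul_add]
  by_cases hξ : ξ = 0
  · have := lpSymbol_zero φ N
    rw [hξ, this, zero_mul]
    simp
  · rw [← hF ξ hξ]
    rfl

/-- The dispersive bound for one Littlewood–Paley piece of the linear evolution. -/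
theorem IsLPBump3.exists_weighted_eLpNorm_LP3_le {φ : E3 → ℝ} (hφ : IsLPBump3 φ) :
    ∃ C : ℝ≥0, ∀ (N t : ℝ), 0 < N → 0 ≤ t → ∀ v w : 𝓢(E3, ℂ),
      ENNReal.ofReal ((1 + t * N) / N) *
        eLpNorm (LP3 φ N (fun x => cosProp3 t v x + sinProp3 t w x)) ∞ volume ≤
      C * (ENNReal.ofReal (N ^ (2 : ℝ)) * (eLpNorm (LP3 φ (N / 2) v) 1 volume +
          eLpNorm (LP3 φ N v) 1 volume + eLpNorm (LP3 φ (2 * N) v) 1 volume) +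
        ENNReal.ofReal (N ^ (1 : ℝ)) * (eLpNorm (LP3 φ (N / 2) w) 1 volume +
          eLpNorm (LP3 φ N w) 1 volume + eLpNorm (LP3 φ (2 * N) w) 1 volume)) := by
  obtain ⟨A, hA, hcos⟩ := hφ.exists_norm_cos_kernel_le
  obtain ⟨B, hB, hsin⟩ := hφ.exists_norm_sin_kernel_le
  refine ⟨(max A B).toNNReal, fun N t hN ht v w => ?_⟩
  generalize hS : eLpNorm (LP3 φ (N / 2) v) 1 volume +
          eLpNorm (LP3 φ N v) 1 volume + eLpNorm (LP3 φ (2 * N) v) 1 volume = S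
  generalize hT : eLpNorm (LP3 φ (N / 2) w) 1 volume +
          eLpNorm (LP3 φ N w) 1 volume + eLpNorm (LP3 φ (2 * N) w) 1 volume = T
  have hle : eLpNorm (LP3 φ N (fun x => cosProp3 t v x + sinProp3 t w x)) ∞ volume ≤
      ENNReal.ofReal (A * N ^ 3 / (1 + t * N)) * S +
        ENNReal.ofReal (B * N ^ 2 / (1 + t * N)) * T := by
    rw [eLpNorm_exponent_top]
    refine eLpNormEssSup_le_of_ae_enorm_bound (.of_forall fun x => ?_)
    rw [hφ.LP3_cosProp3_add_sinProp3 hN ht, ← hS, ← hT]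
    refine (enorm_add_le _ _).trans (add_le_add ?_ ?_)
    · exact hφ.enorm_fourierInv_lpSymbol_mul_le hN (by fun_prop)
        (fun ξ => Real.abs_cos_le_one (2 * Real.pi * t * ‖ξ‖)) (hcos N t hN ht) v x
    · exact hφ.enorm_fourierInv_lpSymbol_mul_le hN (by fun_prop)
        (fun ξ => abs_sin_div_le t (norm_nonneg ξ)) (hsin N t hN ht) w x
  refine (mul_le_mul_right hle _).trans ?_
  have hC : ((max A B).toNNReal : ℝ≥0∞) = ENNReal.ofReal (max A B) := rfl
  have h1 : 0 < 1 + t * N := by positivity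
  rw [hC, mul_add, mul_add, ← mul_assoc, ← mul_assoc, ← mul_assoc, ← mul_assoc,
    ← ENNReal.ofReal_mul (by positivity), ← ENNReal.ofReal_mul (by positivity),
    ← ENNReal.ofReal_mul (by positivity), ← ENNReal.ofReal_mul (by positivity),
    Real.rpow_two, Real.rpow_one,
    show (1 + t * N) / N * (A * N ^ 3 / (1 + t * N)) = A * N ^ 2 by field_simp,
    show (1 + t * N) / N * (B * N ^ 2 / (1 + t * N)) = B * N by field_simp]
  gcongr
  · exact le_max_left _ _
  · exact le_max_right _ _

theorem tsum_rpow_mul_neighbours_le (E : ℝ → ℝ≥0∞) {s : ℝ} (hs : 0 ≤ s) (hs2 : s ≤ 2) :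
    ∑' n : ℤ, ENNReal.ofReal (((2 : ℝ) ^ n) ^ s) *
        (E ((2 : ℝ) ^ n / 2) + E ((2 : ℝ) ^ n) + E (2 * (2 : ℝ) ^ n)) ≤
      6 * ∑' n : ℤ, ENNReal.ofReal (((2 : ℝ) ^ n) ^ s) * E ((2 : ℝ) ^ n) := by
  set w : ℤ → ℝ≥0∞ := fun n => ENNReal.ofReal (((2 : ℝ) ^ n) ^ s) with hw
  have h0 : ∀ n : ℤ, w (n + 1) ≤ 4 * w n := fun n => by
    simp only [hw]
    rw [show (4 : ℝ≥0∞) = ENNReal.ofReal 4 by simp, ← ENNReal.ofReal_mul (by norm_num)]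
    refine ENNReal.ofReal_le_ofReal ?_
    rw [zpow_add_one₀ two_ne_zero, Real.mul_rpow (by positivity) (by positivity), mul_comm]
    gcongr
    calc (2 : ℝ) ^ s ≤ 2 ^ (2 : ℝ) := Real.rpow_le_rpow_of_exponent_le one_le_two hs2
      _ = 4 := by norm_num
  have h1 : ∀ n : ℤ, w (n - 1) ≤ w n := fun n => by
    simp only [hw]
    refine ENNReal.ofReal_le_ofReal (Real.rpow_le_rpow (by positivity) ?_ hs)
    exact zpow_le_zpow_right₀ one_le_two (by lia)
  have e0 : ∑' n : ℤ, w n * E ((2 : ℝ) ^ n / 2) ≤ 4 * ∑' n : ℤ, w n * E ((2 : ℝ) ^ n) := by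
    rw [← (Equiv.addRight (1 : ℤ)).tsum_eq, ← ENNReal.tsum_mul_left]
    refine ENNReal.tsum_le_tsum fun n => ?_
    simp only [Equiv.coe_addRight]
    rw [zpow_add_one₀ two_ne_zero, mul_div_cancel_right₀ _ two_ne_zero, ← mul_assoc]
    gcongr
    exact h0 n
  have e1 : ∑' n : ℤ, w n * E (2 * (2 : ℝ) ^ n) ≤ ∑' n : ℤ, w n * E ((2 : ℝ) ^ n) := by
    rw [← (Equiv.subRight (1 : ℤ)).tsum_eq]
    refine ENNReal.tsum_le_tsum fun n => ?_
    simp only [Equiv.subRight_apply]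
    rw [zpow_sub_one₀ two_ne_zero, mul_comm (2 : ℝ), inv_mul_cancel_right₀ two_ne_zero]
    gcongr
    exact h1 n
  simp only [mul_add]
  rw [ENNReal.tsum_add, ENNReal.tsum_add]
  calc _ ≤ 4 * (∑' n : ℤ, w n * E ((2 : ℝ) ^ n)) + (∑' n : ℤ, w n * E ((2 : ℝ) ^ n)) +
        ∑' n : ℤ, w n * E ((2 : ℝ) ^ n) := by gcongr
    _ = _ := by ring

/-- **Linear-term bound in the weighted bootstrap norm, `L^∞`/Besov version.** -/
theorem linear_term_bound_Linfty (φ : E3 → ℝ) (hφ : IsLPBump3 φ) :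
    ∃ C : ℝ≥0, ∀ (u₀ u₁ : 𝓢(E3, ℝ)),
      (∑' n : ℤ, ⨆ t ∈ Ici (0:ℝ),
          ENNReal.ofReal ((1 + t * (2:ℝ) ^ n) / (2:ℝ) ^ n) *
            eLpNorm
              (LP3 φ ((2:ℝ) ^ n)
                (fun x => cosProp3 t (rc (⇑u₀)) x + sinProp3 t (rc (⇑u₁)) x))
              ∞ volume) ≤
        (C : ℝ≥0∞) * (besov3 φ 2 1 (rc (⇑u₀)) + besov3 φ 1 1 (rc (⇑u₁))) := by
  obtain ⟨C, hC⟩ := hφ.exists_weighted_eLpNorm_LP3_le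
  refine ⟨C * 6, fun u₀ u₁ => ?_⟩
  refine (ENNReal.tsum_le_tsum fun n => iSup₂_le fun t ht =>
    hC (2 ^ n) t (by positivity) ht u₀.rc u₁.rc).trans ?_
  rw [ENNReal.tsum_mul_left, ENNReal.tsum_add, ENNReal.coe_mul, mul_assoc]
  gcongr
  rw [mul_add]
  refine add_le_add ?_ ?_
  · exact tsum_rpow_mul_neighbours_le (fun N => eLpNorm (LP3 φ N u₀.rc) 1 volume)
      zero_le_two le_rfl
  · exact tsum_rpow_mul_neighbours_le (fun N => eLpNorm (LP3 φ N u₁.rc) 1 volume)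
      zero_le_one one_le_two

end
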